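/- Let k ≥ 0 and let (m,n) ∈ U_k, i.e. m ≥ 0, n ≥ 1, f_{2k} ≤ n < f_{2k+3}, and there exists α ∈ E'_{k+1} with α − f_{2k+2} < m+n ≤ α. Then: (1) if n = f_{2k+3} − 1, then H_{m,n} = (−1)^{k+1} (−1)^{f_{2k+5}/2 − Φ_{k+1}(m+n)} · f_{2k+1}/2; (2) if n = f_{2k}, then H_{m,n} = (−1)^{k+1} (−1)^{(f_{2k+2}−1)/2} · f_{2k+1}/2; (3) if f_{2k} < n < f_{2k+3} − 1, then: if m+n ∈ E'_{k+1} or m+n+f_{2k+2}−1 ∈ E'_{k+1}, then H_{m,n} = −(−1)^{(f_{2k+3}−n)k} (−1)^{(f_{2k+3}−1−n)(f_{2k+3}−2−n)/2} · f_{2k+1}/2, and otherwise H_{m,n} = 0. -/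

import Mathlib

/-- The substitution τ: 1 → 101, 0 → 1 on the alphabet {0,1}. -/
def tau (b : ℕ) : List ℕ := if b = 1 then [1, 0, 1] else [1]

/-- The iterated word τ^n(1). -/
def tauIter : ℕ → List ℕ
  | 0 => [1]
  | n + 1 => ((tauIter n).map tau).flatten

/-- `s` is the fixed point of τ beginning with 1: it agrees with every
iterate `τ^n(1)` on its length. -/
def IsFixedSeq (s : ℕ → ℕ) : Prop :=
  ∀ n j, j < (tauIter n).length → s j = (tauIter n).getD j 0

/-- The sequence (f_n): f_0 = 1, f_1 = 2, f_{2n+2} = f_{2n} + f_{2n+1},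
f_{2n+3} = f_{2n} + f_{2n+2}. -/
def IsFSeq (f : ℕ → ℕ) : Prop :=
  f 0 = 1 ∧ f 1 = 2 ∧ (∀ n, f (2*n+2) = f (2*n) + f (2*n+1)) ∧
    (∀ n, f (2*n+3) = f (2*n) + f (2*n+2))

/-- `a` is the f-representation of `n`: digits in {0,1}, finitely supported,
a_i a_{i+1} = 0 for all i, a_i a_{i+2} = 0 for even i, and n = Σ a_i f_i. -/
def IsFRep (f : ℕ → ℕ) (n : ℕ) (a : ℕ → ℕ) : Prop :=
  (∀ i, a i ≤ 1) ∧ (∀ i, a i * a (i+1) = 0) ∧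
  (∀ i, Even i → a i * a (i+2) = 0) ∧
  ∃ N, (∀ i, N ≤ i → a i = 0) ∧ n = ∑ i ∈ Finset.range N, a i * f i

/-- The truncated f-representation Φ_k(n) = Σ_{i=0}^{2k+2} a_i(n) f_i. -/
def Phi (f : ℕ → ℕ) (a : ℕ → ℕ → ℕ) (k n : ℕ) : ℕ :=
  ∑ i ∈ Finset.range (2*k+3), a n i * f i

/-- The Hankel determinant H_{m,n} = det (s_{m+i+j})_{0 ≤ i,j ≤ n-1}. -/
def H (s : ℕ → ℕ) (m n : ℕ) : ℤ :=
  (Matrix.of fun i j : Fin n => (s (m + i.1 + j.1) : ℤ)).det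


/-! ### The words `τ^j(0)` -/

/-- `VW j = τ^j(0)`, so that `VW (j+1) = τ^j(1)`. -/
def VW : ℕ → List ℕ
  | 0 => [0]
  | 1 => [1]
  | (j+2) => VW (j+1) ++ VW j ++ VW (j+1)

lemma VW_len_succ (j : ℕ) :
    (VW (j+1+1)).length = (VW (j+1)).length + (VW j).length + (VW (j+1)).length := by
  rw [VW, List.length_append, List.length_append]

lemma VW_sum_succ (j : ℕ) :
    (VW (j+1+1)).sum = (VW (j+1)).sum + (VW j).sum + (VW (j+1)).sum := by
  rw [VW, List.sum_append, List.sum_append]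

lemma VW_key (i : ℕ) : (VW (i+1)).length = (VW i).sum + (VW (i+1)).sum ∧
    (VW i).length + (VW i).sum = (VW (i+1)).sum := by
  induction i with
  | zero => simp [VW]
  | succ i ih =>
    have e := VW_sum_succ i
    have l := VW_len_succ i
    omega

lemma tau_flatten_VW : ∀ j, ((VW j).map tau).flatten = VW (j+1)
  | 0 => by simp [VW, tau]
  | 1 => by simp [VW, tau]
  | (j+2) => by
    have h1 := tau_flatten_VW j
    have h2 := tau_flatten_VW (j+1)
    rw [show VW (j+2+1) = VW (j+2) ++ VW (j+1) ++ VW (j+2) from rfl, ← h1]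
    rw [show VW (j+2) = VW (j+1) ++ VW j ++ VW (j+1) from rfl]
    simp only [List.map_append, List.flatten_append]
    rw [h2, h1]
    rfl

lemma tauIter_eq : ∀ j, tauIter j = VW (j+1)
  | 0 => rfl
  | (j+1) => by
    rw [tauIter, tauIter_eq j, tau_flatten_VW]

lemma VW_length (f : ℕ → ℕ) (hf : IsFSeq f) (j : ℕ) :
    (VW (j+1)).length = f (2*j) ∧ (VW j).length + f (2*j) = f (2*j+1) := by
  obtain ⟨h0, h1, h2, h3⟩ := hf
  induction j with
  | zero => simp [VW, h0, h1]
  | succ j ih =>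
    have e2 := h2 j
    have e3 := h3 j
    rw [show 2*(j+1) = 2*j+2 by ring]
    have := VW_len_succ j
    have e : f (2*j+2+1) = f (2*j+3) := rfl
    constructor <;> omega

lemma VW_sum (f : ℕ → ℕ) (hf : IsFSeq f) (j : ℕ) :
    2 * (VW (j+1)).sum = f (2*j+1) ∧ (VW j).sum + (VW (j+1)).sum = f (2*j) := by
  obtain ⟨h0, h1, h2, h3⟩ := hf
  induction j with
  | zero => simp [VW, h0, h1]
  | succ j ih =>
    have e2 := h2 j
    have e3 := h3 j
    rw [show 2*(j+1) = 2*j+2 by ring]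
    have := VW_sum_succ j
    have e : f (2*j+2+1) = f (2*j+3) := rfl
    constructor <;> omega

/-- parity of the number of ones -/
lemma VW_sum_parity : ∀ j, (VW j).sum % 2 = j % 2
  | 0 => by simp [VW]
  | 1 => by simp [VW]
  | (j+2) => by
    have h1 := VW_sum_parity j
    have : (VW (j+2)).sum = (VW (j+1)).sum + (VW j).sum + (VW (j+1)).sum := VW_sum_succ j
    omega

lemma f_pos_even (f : ℕ → ℕ) (hf : IsFSeq f) (k : ℕ) : 1 ≤ f (2*k) ∧ f (2*k) % 2 = 1 := by
  obtain ⟨h0, h1, h2, h3⟩ := hf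
  have := VW_sum f ⟨h0, h1, h2, h3⟩
  induction k with
  | zero => simp [h0]
  | succ j ih =>
    have e2 := h2 j
    have := (this j).1
    rw [show 2*(j+1) = 2*j+2 by ring]
    omega

lemma VW_coprime (j : ℕ) : Nat.Coprime (VW (j+1)).length (VW j).length := by
  induction j with
  | zero => simp [VW]
  | succ j ih =>
    have : (VW (j+1+1)).length = (VW j).length + 2 * (VW (j+1)).length := by
      simp [VW]; ring
    rw [this]
    simpa using ih.symm

/-- The near-commutation of consecutive words. -/
lemma VW_swap (j : ℕ) : ∃ (P Q : List ℕ) (c c' : ℕ),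
    VW j ++ VW (j+1) = P ++ ([c, c'] ++ Q) ∧ VW (j+1) ++ VW j = P ++ ([c', c] ++ Q) ∧
    P.length + 1 = (VW (j+1)).sum ∧ (c : ℤ) - c' = (-1)^(j+1) := by
  induction j with
  | zero => exact ⟨[], [], 0, 1, by simp [VW]⟩
  | succ j ih =>
    obtain ⟨P, Q, c, c', h1, h2, h3, h4⟩ := ih
    refine ⟨VW (j+1) ++ P, Q ++ VW (j+1), c', c, ?_, ?_, ?_, ?_⟩
    · rw [show VW (j+1+1) = VW (j+1) ++ VW j ++ VW (j+1) from rfl, h2]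
      simp
    · rw [show VW (j+1+1) = VW (j+1) ++ VW j ++ VW (j+1) from rfl]
      rw [List.append_assoc, List.append_assoc, ← List.append_assoc (VW j), h1]
      simp
    · have e := VW_sum_succ j
      have l := (VW_key j).1
      simp only [List.length_append]
      omega
    · rw [pow_succ, ← h4]; ring

/-! ### Determinant lemmas -/

lemma det_peel {N : ℕ} (A : Matrix (Fin (N+1)) (Fin (N+1)) ℤ) (i j : Fin (N+1))
    (h : ∀ j', j' ≠ j → A i j' = 0) :
    A.det = (-1)^((i:ℕ) + (j:ℕ)) * A i j * (A.submatrix i.succAbove j.succAbove).det := by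
  rw [Matrix.det_succ_row A i]
  rw [Finset.sum_eq_single j]
  · intro b _ hb
    rw [h b hb]; ring
  · simp

lemma tri_succ (n : ℕ) : (n + 1) * n / 2 = n * (n - 1) / 2 + n := by
  simpa using Nat.triangle_succ n

lemma det_right (p : ℕ) (d : ℤ) : ∀ (y : ℕ) (M : ℕ → ℕ → ℤ),
    (∀ i j, i < y → j < p + y → i + j + 1 < p + y → M (p + i) j = 0) →
    (∀ i j, i < y → j < p + y → i + j + 1 = p + y → M (p + i) j = d) →
    (Matrix.of fun i j : Fin (p + y) => M i j).det =
      (-1)^(y * (y-1) / 2) * d^y * (Matrix.of fun i j : Fin p => M i j).det := by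
  intro y
  induction y with
  | zero => intro M _ _; simp
  | succ y ih =>
    intro M h0 h1
    have := det_peel (N := p + y) (Matrix.of fun i j : Fin (p + y + 1) => M i j)
      ⟨p, by omega⟩ (Fin.last _) (by
        intro j' hj'
        have h2 : (j' : ℕ) < p + y := by
          have := j'.2
          have h3 : (j' : ℕ) ≠ p + y := fun h => hj' (Fin.ext (by simpa using h))
          omega
        have := h0 0 j' (by omega) (by omega) (by omega)
        simpa using this)
    have e1 : M p (p + y) = d := by simpa using h1 0 (p+y) (by omega) (by omega) (by omega)
    rw [show (Matrix.of fun i j : Fin (p + (y + 1)) => M i j)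
      = (Matrix.of fun i j : Fin (p + y + 1) => M i j) from rfl, this]
    have e2 : ((Matrix.of fun i j : Fin (p + y + 1) => M i j).submatrix
        (Fin.succAbove ⟨p, by omega⟩) (Fin.last (p+y)).succAbove)
        = Matrix.of fun i j : Fin (p + y) => M (if (i : ℕ) < p then i else i + 1) j := by
      ext i j
      simp only [Matrix.submatrix_apply, Matrix.of_apply, Fin.succAbove, Fin.lt_def,
        Fin.val_castSucc, Fin.val_last]
      simp only [Fin.is_lt, if_true, Fin.val_castSucc]
      congr 1
      split_ifs <;> simp
    rw [e2, ih (fun i j => M (if i < p then i else i + 1) j)]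
    · have e3 : (Matrix.of fun i j : Fin p => M (if (i:ℕ) < p then i else i + 1) j)
          = Matrix.of fun i j : Fin p => M i j := by
        ext i j
        simp
      rw [e3]
      simp only [Matrix.of_apply, Fin.val_last, e1, Nat.add_sub_cancel]
      rw [tri_succ, pow_add, pow_add, pow_add, pow_succ]
      have : ((-1:ℤ)^p * (-1)^p) = 1 := by rw [← mul_pow]; simp
      linear_combination ((-1 : ℤ)^y * d * (-1) ^ (y * (y - 1) / 2) * d^y *
        (Matrix.of fun i j : Fin p => M i j).det) * this
    · intro i j hi hj hij
      have := h0 (i+1) j (by omega) (by omega) (by omega)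
      simp only [show ¬ (p + i < p) by omega, if_false]
      exact this
    · intro i j hi hj hij
      have := h1 (i+1) j (by omega) (by omega) (by omega)
      simp only [show ¬ (p + i < p) by omega, if_false]
      exact this

lemma det_left (p : ℕ) (hp : p % 2 = 1) (y : ℕ) (d d' : ℤ) : ∀ (x : ℕ) (M : ℕ → ℕ → ℤ),
    (∀ i j, i < x → j < p + y + x → x ≤ i + j → M (p + i) j = 0) →
    (∀ i j, i < x → j < p + y + x → i + j + 1 = x → M (p + i) j = d) →
    (∀ i j, i < y → j < p + y + x → i + j + 1 < p + y + x → M (p + x + i) j = 0) →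
    (∀ i j, i < y → j < p + y + x → i + j + 1 = p + y + x → M (p + x + i) j = d') →
    (Matrix.of fun i j : Fin (p + y + x) => M i j).det =
      (-1)^((x+1) * x / 2) * d^x * ((-1)^(y * (y-1) / 2) * d'^y *
        (Matrix.of fun i j : Fin p => M i (x + j)).det) := by
  intro x
  induction x with
  | zero =>
    intro M _ _ h2 h3
    have := det_right p d' y M (by simpa using h2) (by simpa using h3)
    simpa using this
  | succ x ih =>
    intro M h0 h1 h2 h3
    have := det_peel (N := p + y + x) (Matrix.of fun i j : Fin (p + y + x + 1) => M i j)
      ⟨p + x, by omega⟩ 0 (by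
        intro j' hj'
        have h3 : (j' : ℕ) ≠ 0 := fun h => hj' (Fin.ext (by simpa using h))
        have := h0 x j' (by omega) (by omega) (by omega)
        simpa using this)
    have e1 : M (p + x) 0 = d := by simpa using h1 x 0 (by omega) (by omega) (by omega)
    rw [show (Matrix.of fun i j : Fin (p + y + (x + 1)) => M i j)
      = (Matrix.of fun i j : Fin (p + y + x + 1) => M i j) from rfl, this]
    have e2 : ((Matrix.of fun i j : Fin (p + y + x + 1) => M i j).submatrix
        (Fin.succAbove ⟨p + x, by omega⟩) (Fin.succAbove 0))
        = Matrix.of fun i j : Fin (p + y + x) =>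
            M (if (i : ℕ) < p + x then i else i + 1) (j+1) := by
      ext i j
      simp only [Matrix.submatrix_apply, Matrix.of_apply, Fin.succAbove_zero, Fin.val_succ]
      simp only [Fin.succAbove, Fin.lt_def, Fin.val_castSucc]
      congr 1
      split_ifs <;> simp
    rw [e2, ih (fun i j => M (if i < p + x then i else i + 1) (j+1))]
    · have e3 : (Matrix.of fun i j : Fin p =>
            M (if (i:ℕ) < p + x then i else i + 1) (x + j + 1))
          = Matrix.of fun i j : Fin p => M i (x + 1 + j) := by
        ext i j
        have := i.2
        simp only [Matrix.of_apply, show (i:ℕ) < p + x by omega, if_true]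
        congr 1; ring
      rw [e3]
      simp only [Matrix.of_apply, Fin.val_zero, e1, add_zero]
      have t := tri_succ (x+1)
      simp only [Nat.add_sub_cancel] at t
      rw [t, pow_add, pow_add, pow_succ, pow_succ]
      have : ((-1:ℤ)^p) = -1 := Odd.neg_one_pow (Nat.odd_iff.2 hp)
      rw [this]
      ring
    · intro i j hi hj hij
      have := h0 i (j+1) (by omega) (by omega) (by omega)
      simp only [show (p + i < p + x) by omega, if_true]
      exact this
    · intro i j hi hj hij
      have := h1 i (j+1) (by omega) (by omega) (by omega)
      simp only [show (p + i < p + x) by omega, if_true]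
      exact this
    · intro i j hi hj hij
      have := h2 i (j+1) (by omega) (by omega) (by omega)
      simp only [show ¬ (p + x + i < p + x) by omega, if_false]
      rw [← this]; congr 1; ring
    · intro i j hi hj hij
      have := h3 i (j+1) (by omega) (by omega) (by omega)
      simp only [show ¬ (p + x + i < p + x) by omega, if_false]
      rw [← this]; congr 1; ring

/-- Subtracting the row `i - p` from the row `i` for every `i ≥ p`. -/
lemma det_rowdiff (n p : ℕ) (hp : 0 < p) (M : ℕ → ℕ → ℤ) :
    (Matrix.of fun i j : Fin n => M i j).det =
    (Matrix.of fun i j : Fin n => if (i:ℕ) < p then M i j else M i j - M (i - p) j).det := by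
  set U : Matrix (Fin n) (Fin n) ℤ := Matrix.of fun i j =>
    (if i = j then 1 else 0) - (if (i : ℕ) = j + p then 1 else 0) with hU
  have hdet : U.det = 1 := by
    rw [Matrix.det_of_isLowerTriangular]
    · apply Finset.prod_eq_one
      intro i _
      simp [hU]
      omega
    · intro i j hij
      have hij' : (i : ℕ) < j := by simpa using hij
      simp only [hU, Matrix.of_apply]
      rw [if_neg (by intro h; subst h; omega), if_neg (by omega)]
      simp
  have hmul : (Matrix.of fun i j : Fin n =>
      if (i:ℕ) < p then M i j else M i j - M (i - p) j)
      = U * (Matrix.of fun i j : Fin n => M i j) := by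
    ext i j
    simp only [Matrix.mul_apply, hU, Matrix.of_apply, sub_mul, Finset.sum_sub_distrib,
      ite_mul, one_mul, zero_mul, Finset.sum_ite_eq, Finset.mem_univ, if_true]
    split_ifs with h
    · rw [Finset.sum_eq_zero, sub_zero]
      intro l _
      rw [if_neg (by omega)]
    · rw [Finset.sum_eq_single ⟨(i:ℕ) - p, by omega⟩]
      · simp; intro; omega
      · intro b _ hb
        rw [if_neg]
        intro hh
        apply hb
        apply Fin.ext
        simp; omega
      · simp
  rw [hmul, Matrix.det_mul, hdet, one_mul]

/-- Hankel determinants of a sequence which is `p`-periodic in the middle. -/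
lemma hankel_block (h : ℕ → ℤ) (p x y : ℕ) (hp : p % 2 = 1) (d d' : ℤ)
    (h0 : ∀ e, x ≤ e → e + 1 < x + (p + y + x) → h (e + p) - h e = 0)
    (h1 : 0 < x → h (x - 1 + p) - h (x - 1) = d)
    (h2 : 0 < y → h (x + (p + y + x) - 1 + p) - h (x + (p + y + x) - 1) = d') :
    (Matrix.of fun i j : Fin (p + y + x) => h (i + j)).det =
      (-1)^((x+1) * x / 2) * d^x * ((-1)^(y * (y-1) / 2) * d'^y *
        (Matrix.of fun i j : Fin p => h (x + i + j)).det) := by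
  rw [det_rowdiff _ p (by omega) (fun i j => h (i + j))]
  have := det_left p hp y d d' x
    (fun i j => if i < p then h (i + j) else h (i + j) - h (i - p + j)) ?_ ?_ ?_ ?_
  · rw [this]
    congr 4
    ext i j
    simp only [i.2, if_true]
    congr 1; ring
  · intro i j hi hj hij
    simp only [show ¬ (p + i < p) by omega, if_false, Nat.add_sub_cancel_left]
    rw [← h0 (i + j) (by omega) (by omega)]
    congr 2; ring
  · intro i j hi hj hij
    simp only [show ¬ (p + i < p) by omega, if_false, Nat.add_sub_cancel_left]
    rw [← h1 (by omega), show x - 1 = i + j by omega]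
    congr 2; ring
  · intro i j hi hj hij
    simp only [show ¬ (p + x + i < p) by omega, if_false]
    rw [← h0 (x + i + j) (by omega) (by omega)]
    congr 2 <;> omega
  · intro i j hi hj hij
    simp only [show ¬ (p + x + i < p) by omega, if_false]
    rw [← h2 (by omega)]
    congr 2 <;> omega

lemma sign_rev_aux (p : ℕ) :
    ((Equiv.Perm.sign (Fin.revPerm : Equiv.Perm (Fin (0 + p))) : ℤˣ) : ℤ)
    = (-1)^(p * (p-1)/2) := by
  have h := Matrix.det_permute' (Fin.revPerm : Equiv.Perm (Fin (0 + p))) (1 : Matrix _ _ ℤ)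
  rw [Matrix.det_one, mul_one] at h
  have h' := det_right 0 1 p (fun i j => if i + j + 1 = p then 1 else 0)
    (by intro i j _ _ h; rw [if_neg (by omega)]) (by intro i j _ _ h; rw [if_pos (by omega)])
  simp only [Matrix.det_isEmpty, one_pow, mul_one] at h'
  rw [← h']
  have e : (1 : Matrix (Fin (0 + p)) (Fin (0 + p)) ℤ).submatrix id Fin.revPerm
      = Matrix.of fun i j : Fin (0 + p) => if (i:ℕ) + j + 1 = p then 1 else 0 := by
    ext i j
    simp only [Matrix.submatrix_apply, Matrix.one_apply, Matrix.of_apply, id, Fin.ext_iff,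
      Fin.revPerm_apply, Fin.val_rev]
    congr 1
    apply propext
    omega
  rw [← e, h]
  simp

lemma sign_rev (p : ℕ) : ((Equiv.Perm.sign (Fin.revPerm : Equiv.Perm (Fin p)) : ℤˣ) : ℤ)
    = (-1)^(p * (p-1)/2) := by
  have := sign_rev_aux p
  rwa [zero_add] at this

/-! ### Circulant determinants -/

/-- `I - P + tJ`. -/
def LJ (p : ℕ) (t : ℚ) : Matrix (ZMod p) (ZMod p) ℚ :=
  Matrix.of fun i j => (if i = j then 1 else 0) - (if i = j + 1 then 1 else 0) + t

lemma sum_delta (p : ℕ) [NeZero p] (c : ZMod p) (F : ZMod p → ℚ) :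
    ∑ x, F x * (if x = c then 1 else 0) = F c := by
  simp

lemma LJ_det (p : ℕ) [NeZero p] (t : ℚ) : (LJ p t).det = t * (LJ p 1).det := by
  have hp : (p : ℚ) ≠ 0 := by exact_mod_cast NeZero.ne p
  have h1 : LJ p t = LJ p 1 * (1 + Matrix.replicateCol Unit (fun _ => (t-1)/p) *
      Matrix.replicateRow Unit (fun _ => (1:ℚ))) := by
    ext i j
    rw [mul_add, mul_one, Matrix.add_apply, Matrix.mul_apply]
    simp only [LJ, Matrix.of_apply, Matrix.mul_apply, Matrix.replicateCol_apply,
      Matrix.replicateRow_apply, Finset.univ_unique, Finset.sum_const, Finset.card_singleton]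
    rw [← Finset.sum_mul, Finset.sum_add_distrib, Finset.sum_sub_distrib]
    have e1 : ∑ x : ZMod p, (if i = x then (1:ℚ) else 0) = 1 := by simp
    have e2 : ∑ x : ZMod p, (if i = x + 1 then (1:ℚ) else 0) = 1 := by
      have : ∀ x : ZMod p, (i = x + 1) ↔ (x = i - 1) := by
        intro x; constructor <;> intro h <;> rw [h] <;> ring
      simp [this]
    rw [e1, e2]
    simp [ZMod.card]
    field_simp
    ring
  rw [h1, Matrix.det_mul, Matrix.det_one_add_replicateCol_mul_replicateRow]
  simp [dotProduct, ZMod.card]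
  field_simp
  ring

lemma LJ_det_ne (p : ℕ) [NeZero p] : (LJ p 1).det ≠ 0 := by
  have hp : (p : ℚ) ≠ 0 := by exact_mod_cast NeZero.ne p
  intro h
  rw [← Matrix.exists_vecMul_eq_zero_iff] at h
  obtain ⟨v, hv, h⟩ := h
  have h1 : ∀ j, v j - v (j+1) + ∑ x, v x = 0 := by
    intro j
    have := congrFun h j
    simp only [Matrix.vecMul, dotProduct, LJ, Matrix.of_apply, mul_add, mul_sub, mul_one,
      Finset.sum_add_distrib, Finset.sum_sub_distrib, sum_delta, Pi.zero_apply] at this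
    exact this
  have h2 : ∑ x, v x = 0 := by
    have := Finset.sum_eq_zero (s := Finset.univ) (fun j _ => h1 j)
    rw [Finset.sum_add_distrib, Finset.sum_sub_distrib] at this
    have e : ∑ x : ZMod p, v (x + 1) = ∑ x, v x := Equiv.sum_comp (Equiv.addRight 1) v
    rw [e] at this
    simp [ZMod.card, hp] at this
    exact this
  have h3 : ∀ j, v (j+1) = v j := by
    intro j
    have := h1 j
    rw [h2] at this
    linarith
  have h4 : ∀ n : ℕ, v n = v 0 := by
    intro n
    induction n with
    | zero => simp
    | succ n ih => rw [Nat.cast_succ, h3, ih]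
  have h5 : ∀ j, v j = v 0 := by
    intro j
    have := h4 j.val
    rwa [ZMod.natCast_zmod_val] at this
  simp only [h5] at h2
  simp [ZMod.card, hp] at h2
  apply hv
  ext j
  rw [h5, h2]; rfl

lemma sign_shift (p : ℕ) [NeZero p] (hp : p % 2 = 1) (b : ZMod p) :
    Equiv.Perm.sign (Equiv.addRight b : Equiv.Perm (ZMod p)) = 1 := by
  have h : (Equiv.addRight b : Equiv.Perm (ZMod p))^p = 1 := by
    have key : ∀ (n : ℕ) (x : ZMod p),
        ((Equiv.addRight b : Equiv.Perm (ZMod p))^n) x = x + n * b := by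
      intro n
      induction n with
      | zero => simp
      | succ n ih =>
        intro x
        rw [pow_succ', Equiv.Perm.mul_apply, ih, Equiv.coe_addRight]
        push_cast
        ring
    ext x
    rw [key]
    simp
  have h2 := congrArg Equiv.Perm.sign h
  rw [map_pow, map_one] at h2
  rcases Int.units_eq_one_or (Equiv.Perm.sign (Equiv.addRight b : Equiv.Perm (ZMod p))) with h3 | h3
  · exact h3
  · rw [h3, Odd.neg_one_pow (Nat.odd_iff.2 hp)] at h2
    exact absurd h2 (by decide)

lemma circ_det (p : ℕ) [NeZero p] (hp : p % 2 = 1) (g : ZMod p → ℚ) (r b : ZMod p)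
    (hr : IsUnit r) (ε : ℚ) (hε : ε * ε = 1)
    (hg : ∀ x, g (x + r) - g x = ε * ((if x = b then 1 else 0) - (if x = b + 1 then 1 else 0))) :
    (Matrix.of fun i j => g (i - j)).det = ∑ x, g x := by
  obtain ⟨u, rfl⟩ := hr
  set K : Matrix (ZMod p) (ZMod p) ℚ := Matrix.of fun i j =>
    (if i = j - u then 1 else 0) - (if i = j then 1 else 0) + 1 with hK
  have hKdet : K.det = (LJ p 1).det := by
    rw [← Matrix.det_submatrix_equiv_self (Units.mulLeft u) K]
    have h := Matrix.det_permute (Equiv.addRight (-1) : Equiv.Perm (ZMod p))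
      (K.submatrix (Units.mulLeft u) (Units.mulLeft u))
    rw [sign_shift p hp] at h
    simp only [Units.val_one, Int.cast_one, one_mul] at h
    rw [← h]
    congr 1
    ext i j
    simp only [hK, LJ, Matrix.submatrix_apply, Matrix.of_apply, Units.mulLeft_apply,
      Equiv.coe_addRight, id]
    have e1 : ((u:ZMod p) * (i + -1) = u * j - u) ↔ i = j := by
      rw [show (u:ZMod p) * j - u = u * (j + -1) by ring]
      rw [Units.mul_right_inj]
      exact add_left_inj _
    have e2 : ((u:ZMod p) * (i + -1) = u * j) ↔ i = j + 1 := by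
      rw [Units.mul_right_inj]
      constructor
      · intro h; rw [← h]; ring
      · intro h; rw [h]; ring
    simp only [e1, e2]
  have hmul : (Matrix.of fun i j => g (i - j)) * K
      = ε • (LJ p (ε * ∑ x, g x)).submatrix (Equiv.addRight (-b) : Equiv.Perm (ZMod p)) id := by
    ext i j
    simp only [Matrix.mul_apply, hK, Matrix.of_apply, mul_add, mul_sub, mul_one,
      Finset.sum_add_distrib, Finset.sum_sub_distrib, sum_delta]
    simp only [Matrix.smul_apply, Matrix.submatrix_apply, LJ, Matrix.of_apply,
      Equiv.coe_addRight, id, smul_eq_mul]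
    have e : ∑ x, g (i - x) = ∑ x, g x := Equiv.sum_comp (Equiv.subLeft i) g
    rw [e, show i - (j - (u:ZMod p)) = (i - j) + u by ring, hg]
    have e1 : (i - j = b) ↔ (i + -b = j) := by
      constructor <;> intro h
      · rw [← h]; ring
      · rw [← h]; ring
    have e2 : (i - j = b + 1) ↔ (i + -b = j + 1) := by
      constructor <;> intro h
      · linear_combination h
      · linear_combination h
    simp only [e1, e2]
    linear_combination (- ∑ x, g x) * hε
  have h := congrArg Matrix.det hmul
  rw [Matrix.det_mul, hKdet, Matrix.det_smul, Matrix.det_permute, sign_shift p hp, LJ_det p (ε * _),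
    ZMod.card] at h
  have hεp : ε ^ p * ε = 1 := by
    rw [← pow_succ]
    obtain ⟨q, hq⟩ : ∃ q, p + 1 = 2 * q := ⟨(p+1)/2, by omega⟩
    rw [hq, pow_mul, pow_two, hε, one_pow]
  simp only [Units.val_one, Int.cast_one, one_mul] at h
  apply mul_right_cancel₀ (LJ_det_ne p)
  rw [h]
  linear_combination (∑ x, g x) * (LJ p 1).det * hεp

/-- Hankel determinant of a periodic window. -/
lemma hankel_circ (p : ℕ) [NeZero p] (hp : p % 2 = 1) (g : ZMod p → ℤ) (r b : ZMod p)
    (hr : IsUnit r) (ε : ℤ) (hε : ε * ε = 1)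
    (hg : ∀ x, g (x + r) - g x = ε * ((if x = b then 1 else 0) - (if x = b + 1 then 1 else 0)))
    (c : ZMod p) :
    (Matrix.of fun i j : Fin p => g (c + (i : ℕ) + (j : ℕ))).det
      = (-1)^(p * (p-1)/2) * ∑ x, g x := by
  have hc := circ_det p hp (fun x => ((g (x + (c - 1)) : ℤ) : ℚ)) r (b - (c - 1)) hr ε
    (by exact_mod_cast hε) (by
      intro x
      have := hg (x + (c - 1))
      rw [show x + r + (c - 1) = x + (c - 1) + r by ring]
      have e1 : (x + (c - 1) = b) ↔ (x = b - (c - 1)) := by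
        constructor <;> intro h <;> linear_combination h
      have e2 : (x + (c - 1) = b + 1) ↔ (x = b - (c - 1) + 1) := by
        constructor <;> intro h <;> linear_combination h
      simp only [e1, e2] at this
      exact_mod_cast this)
  have e : ∑ x, ((g (x + (c - 1)) : ℤ) : ℚ) = ((∑ x, g x : ℤ) : ℚ) := by
    push_cast
    exact Equiv.sum_comp (Equiv.addRight (c-1)) (fun x => ((g x : ℤ) : ℚ))
  rw [e] at hc
  have h1 := Matrix.det_permute' (Fin.revPerm : Equiv.Perm (Fin p))
    (Matrix.of fun i j : Fin p => g (c + (i : ℕ) - (j : ℕ) - 1))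
  rw [sign_rev] at h1
  have e2 : (Matrix.of fun i j : Fin p => g (c + (i : ℕ) - (j : ℕ) - 1)).submatrix id Fin.revPerm
      = Matrix.of fun i j : Fin p => g (c + (i : ℕ) + (j : ℕ)) := by
    ext i j
    simp only [Matrix.submatrix_apply, Matrix.of_apply, id, Fin.revPerm_apply, Fin.val_rev]
    congr 1
    rw [Nat.cast_sub (by omega)]
    push_cast
    rw [ZMod.natCast_self]
    ring
  rw [← e2, h1]
  congr 1
  let E : Fin p ≃ ZMod p :=
    { toFun := fun i => ((i : ℕ) : ZMod p)
      invFun := fun x => ⟨x.val, ZMod.val_lt x⟩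
      left_inv := fun i => Fin.ext (by simpa using ZMod.val_cast_of_lt i.2)
      right_inv := fun x => by simp }
  have e3 : (Matrix.of fun i j : Fin p => g (c + (i : ℕ) - (j : ℕ) - 1)) =
      (Matrix.of fun i j : ZMod p => g (i - j + (c - 1))).submatrix E E := by
    ext i j
    simp only [Matrix.submatrix_apply, Matrix.of_apply, E, Equiv.coe_fn_mk]
    congr 1; ring
  rw [e3, Matrix.det_submatrix_equiv_self]
  have e4 : ((Matrix.of fun i j : ZMod p => g (i - j + (c - 1))).det : ℚ)
      = (Matrix.of fun i j : ZMod p => ((g (i - j + (c - 1)) : ℤ) : ℚ)).det := by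
    have := RingHom.map_det (Int.castRingHom ℚ) (Matrix.of fun i j : ZMod p => g (i - j + (c - 1)))
    simp only [Int.coe_castRingHom] at this
    rw [this]
    rfl
  have : ((Matrix.of fun i j : ZMod p => g (i - j + (c - 1))).det : ℚ)
    = ((∑ x, g x : ℤ) : ℚ) := by rw [e4]; exact hc
  exact_mod_cast this

/-! ### Combinatorics of the words -/

lemma getD_swap (A B : List ℕ) (c c' i : ℕ) :
    (((A ++ ([c, c'] ++ B)).getD i 0 : ℕ) : ℤ) - (((A ++ ([c', c] ++ B)).getD i 0 : ℕ) : ℤ)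
      = ((c : ℤ) - c') * ((if i = A.length then 1 else 0) - (if i = A.length + 1 then 1 else 0)) := by
  rcases lt_or_ge i A.length with h | h
  · rw [List.getD_append _ _ _ _ h, List.getD_append _ _ _ _ h, if_neg (by omega),
      if_neg (by omega)]
    ring
  · rw [List.getD_append_right _ _ _ _ h, List.getD_append_right _ _ _ _ h]
    obtain ⟨j, rfl⟩ := Nat.exists_eq_add_of_le h
    rw [Nat.add_sub_cancel_left]
    match j with
    | 0 => simp
    | 1 => simp
    | (j+2) =>
      rw [if_neg (by omega), if_neg (by omega)]
      simp

lemma VW_pos : ∀ j, 0 < (VW j).length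
  | 0 => by simp [VW]
  | 1 => by simp [VW]
  | (j+2) => by
    have := VW_pos (j+1)
    have := VW_len_succ j
    simp only [show j + 2 = j + 1 + 1 by ring]
    omega

lemma VW_runs_aux (k : ℕ) (hu : 0 < (VW (k+1)).sum) (i : ℕ)
    (hi : i < 4 * (VW (k+1)).length + 2 * (VW k).length) :
    (((VW (k+3)).getD (i + (VW (k+1)).length) 0 : ℕ) : ℤ) - (((VW (k+3)).getD i 0 : ℕ) : ℤ)
    = (-1)^(k+1) * ((if i = (VW (k+1)).sum - 1 then 1 else 0)
        - (if i = (VW (k+1)).sum then 1 else 0)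
        + (if i = 3 * (VW (k+1)).length + (VW k).length + (VW (k+1)).sum - 1 then 1 else 0)
        - (if i = 3 * (VW (k+1)).length + (VW k).length + (VW (k+1)).sum then 1 else 0)) := by
  obtain ⟨P, Q, c, c', h1, h2, h3, h4⟩ := VW_swap k
  set V := VW (k+1) with hV
  set U := VW k with hU
  have e1 : VW (k+3) = V ++ ((U ++ V) ++ (V ++ (V ++ (U ++ V)))) := by
    rw [show VW (k+3) = VW (k+2) ++ VW (k+1) ++ VW (k+2) from rfl,
      show VW (k+2) = VW (k+1) ++ VW k ++ VW (k+1) from rfl]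
    simp [hV, hU]
  have e2 : VW (k+3) = ((V ++ U) ++ (V ++ (V ++ (V ++ U)))) ++ V := by
    rw [e1]; simp
  have l1 := congrArg List.length h1
  simp only [List.length_append, List.length_cons, List.length_nil] at l1
  have f1 : (VW (k+3)).getD (i + V.length) 0
      = ((U ++ V) ++ (V ++ (V ++ (U ++ V)))).getD i 0 := by
    rw [e1, List.getD_append_right _ _ _ _ (by omega), Nat.add_sub_cancel]
  have f2 : (VW (k+3)).getD i 0
      = ((V ++ U) ++ (V ++ (V ++ (V ++ U)))).getD i 0 := by
    rw [e2, List.getD_append]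
    simp only [List.length_append]
    omega
  rw [f1, f2, h1, h2]
  have g1 := getD_swap P (Q ++ (V ++ (V ++ (P ++ ([c, c'] ++ Q))))) c c' i
  have g2 := getD_swap (P ++ ([c', c] ++ Q) ++ (V ++ (V ++ P))) Q c c' i
  have t1 : P ++ ([c, c'] ++ Q) ++ (V ++ (V ++ (P ++ ([c, c'] ++ Q))))
    = P ++ ([c, c'] ++ (Q ++ (V ++ (V ++ (P ++ ([c, c'] ++ Q)))))) := by simp
  have t2 : P ++ ([c', c] ++ Q) ++ (V ++ (V ++ P)) ++ ([c, c'] ++ Q)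
    = P ++ ([c', c] ++ (Q ++ (V ++ (V ++ (P ++ ([c, c'] ++ Q)))))) := by simp
  have t3 : P ++ ([c', c] ++ Q) ++ (V ++ (V ++ P)) ++ ([c', c] ++ Q)
    = P ++ ([c', c] ++ Q) ++ (V ++ (V ++ (P ++ ([c', c] ++ Q)))) := by simp
  have l2 : (P ++ ([c', c] ++ Q) ++ (V ++ (V ++ P))).length
      = 3 * V.length + U.length + V.sum - 1 := by
    simp only [List.length_append, List.length_cons, List.length_nil]
    omega
  rw [t2, t3, l2, show 3 * V.length + U.length + V.sum - 1 + 1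
    = 3 * V.length + U.length + V.sum by omega] at g2
  rw [t1, ← h4]
  rw [h3, show P.length = V.sum - 1 by omega] at g1
  linear_combination g1 + g2

lemma VW_mid (k i : ℕ) (hi : i < (VW (k+1)).length) :
    (VW (k+3)).getD ((VW (k+1)).length + (VW k).length + i) 0 = (VW (k+1)).getD i 0 := by
  have e1 : VW (k+3) = (VW (k+1) ++ VW k) ++ (VW (k+1) ++ (VW (k+1) ++
      (VW (k+1) ++ (VW k ++ VW (k+1))))) := by
    rw [show VW (k+3) = VW (k+2) ++ VW (k+1) ++ VW (k+2) from rfl,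
      show VW (k+2) = VW (k+1) ++ VW k ++ VW (k+1) from rfl]
    simp
  rw [e1, List.getD_append_right _ _ _ _ (by simp only [List.length_append]; omega),
    List.length_append, Nat.add_sub_cancel_left, List.getD_append _ _ _ _ hi]

lemma sum_zmod_getD (l : List ℕ) [NeZero l.length] :
    ∑ x : ZMod l.length, ((l.getD x.val 0 : ℕ) : ℤ) = (l.sum : ℤ) := by
  let E : Fin l.length ≃ ZMod l.length :=
    { toFun := fun i => ((i : ℕ) : ZMod l.length)
      invFun := fun x => ⟨x.val, ZMod.val_lt x⟩
      left_inv := fun i => Fin.ext (by simpa using ZMod.val_cast_of_lt i.2)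
      right_inv := fun x => by simp }
  rw [← Equiv.sum_comp E]
  have : ∀ i : Fin l.length, ((l.getD (E i).val 0 : ℕ) : ℤ) = ((l.get i : ℕ) : ℤ) := by
    intro i
    have : (E i).val = i := by simpa [E] using ZMod.val_cast_of_lt i.2
    rw [this]
    simp
  simp only [this]
  rw [← Nat.cast_sum]
  congr 1
  exact Fin.sum_univ_getElem l

/-- The Hankel determinant of the periodic word. -/
lemma hankel_VW (j : ℕ) (hodd : (VW (j+1)).length % 2 = 1) (c : ℕ) :
    (Matrix.of fun i i' : Fin (VW (j+1)).length =>
      (((VW (j+1)).getD ((c + i + i') % (VW (j+1)).length) 0 : ℕ) : ℤ)).det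
    = (-1)^((VW (j+1)).length * ((VW (j+1)).length-1)/2) * ((VW (j+1)).sum : ℤ) := by
  rcases j with _ | j
  · have : ∀ i : ℕ, (i % (VW (0+1)).length) = 0 := by intro i; simp [VW, Nat.mod_one]
    simp only [this]
    have h2 : (VW (0+1)).length = 1 := rfl
    simp [VW]
    rfl
  · have : NeZero (VW (j+1+1)).length := ⟨(VW_pos _).ne'⟩
    obtain ⟨P, Q, a, a', h1, h2, h3, h4⟩ := VW_swap j
    have hl := VW_len_succ j
    have hcop := VW_coprime (j+1)
    set V := VW (j+1) with hV
    set U := VW j with hU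
    set W := VW (j+1+1) with hW
    have w1 : W = V ++ (U ++ V) := by
      rw [hW, show VW (j+1+1) = VW (j+1) ++ VW j ++ VW (j+1) from rfl]; simp [hV, hU]
    have w2 : W = P ++ ([a', a] ++ (Q ++ V)) := by
      rw [w1, ← List.append_assoc, h2]; simp
    have w3 : W.rotate V.length = P ++ ([a, a'] ++ (Q ++ V)) := by
      rw [w1, List.rotate_append_length_eq, h1]; simp
    have l1 := congrArg List.length h1
    simp only [List.length_append, List.length_cons, List.length_nil] at l1
    have hc := hankel_circ W.length hodd (fun x => ((W.getD x.val 0 : ℕ) : ℤ)) (V.length : ℕ)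
      (P.length : ℕ) ((ZMod.isUnit_iff_coprime _ _).2 hcop.symm) ((a:ℤ) - a')
      (by rw [h4, ← pow_add]; exact Even.neg_one_pow ⟨j+1, rfl⟩) (by
        intro x
        have hx := ZMod.val_lt x
        have r1 : W.getD (x + (V.length : ℕ)).val 0 = (W.rotate V.length).getD x.val 0 := by
          rw [ZMod.val_add, ZMod.val_natCast, Nat.add_mod_mod]
          rw [List.getD_eq_getElem?_getD, List.getD_eq_getElem?_getD, List.getElem?_rotate hx]
        rw [r1]
        have g := getD_swap P (Q ++ V) a a' x.val
        rw [← w2, ← w3] at g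
        rw [g]
        have e1 : (x = ((P.length : ℕ) : ZMod W.length)) ↔ x.val = P.length := by
          constructor
          · intro h; rw [h, ZMod.val_cast_of_lt (by omega)]
          · intro h; rw [← h]; simp
        have e2 : (x = ((P.length : ℕ) : ZMod W.length) + 1) ↔ x.val = P.length + 1 := by
          constructor
          · intro h
            rw [h, ← Nat.cast_succ, ZMod.val_cast_of_lt (by omega)]
          · intro h; rw [← Nat.cast_succ, Nat.succ_eq_add_one, ← h]; simp
        simp only [e1, e2]) (c : ℕ)
    rw [sum_zmod_getD] at hc
    rw [← hc]
    congr 1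
    ext i i'
    simp only [Matrix.of_apply]
    rw [← Nat.cast_add, ← Nat.cast_add, ZMod.val_natCast]

/-! ### The numeration system -/

/-- The digit conditions. -/
def Valid (a : ℕ → ℕ) : Prop :=
  (∀ i, a i ≤ 1) ∧ (∀ i, a i * a (i+1) = 0) ∧ (∀ i, Even i → a i * a (i+2) = 0)

lemma f_lt_succ (f : ℕ → ℕ) (hf : IsFSeq f) (j : ℕ) :
    f (2*j) < f (2*j+1) ∧ f (2*j+1) < f (2*j+2) := by
  have h := VW_length f hf j
  have h2 := VW_pos j
  have h3 := hf.2.2.1 j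
  have := f_pos_even f hf j
  omega

lemma f_strictMono (f : ℕ → ℕ) (hf : IsFSeq f) : StrictMono f := by
  apply strictMono_nat_of_lt_succ
  intro n
  rcases Nat.even_or_odd' n with ⟨j, rfl | rfl⟩
  · exact (f_lt_succ f hf j).1
  · exact (f_lt_succ f hf j).2

lemma rep_lt_aux (f : ℕ → ℕ) (hf : IsFSeq f) (a : ℕ → ℕ) (ha : Valid a) (j : ℕ) :
    ∑ i ∈ Finset.range (2*j), a i * f i < f (2*j) ∧
    ∑ i ∈ Finset.range (2*j+1), a i * f i < f (2*j+1) := by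
  obtain ⟨a1, a2, a3⟩ := ha
  induction j with
  | zero =>
    have := a1 0
    simp [hf.1, hf.2.1]
    omega
  | succ j ih =>
    obtain ⟨i1, i2⟩ := ih
    have l := f_lt_succ f hf j
    have l' := f_lt_succ f hf (j+1)
    have e2 := hf.2.2.1 j
    have e3 := hf.2.2.2 j
    have b1 := a1 (2*j+1)
    have b2 := a1 (2*j+2)
    have c1 := a2 (2*j)
    have c2 := a2 (2*j+1)
    have c3 := a3 (2*j) ⟨j, by ring⟩
    rw [show 2*(j+1) = 2*j+2 by ring] at *
    rw [Finset.sum_range_succ] at i2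
    have s1 : ∑ i ∈ Finset.range (2*j+2), a i * f i < f (2*j+2) := by
      rw [Finset.sum_range_succ, Finset.sum_range_succ]
      rcases Nat.le_one_iff_eq_zero_or_eq_one.1 b1 with h | h
      · rw [h]; omega
      · have : a (2*j) = 0 := by simpa [h] using c1
        rw [h, this]; omega
    refine ⟨s1, ?_⟩
    rw [Finset.sum_range_succ]
    rcases Nat.le_one_iff_eq_zero_or_eq_one.1 b2 with h | h
    · rw [h]; omega
    · have h5 : a (2*j) = 0 := by simpa [h] using c3
      have h6 : a (2*j+1) = 0 := by simpa [h] using c2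
      rw [Finset.sum_range_succ, Finset.sum_range_succ, h, h5, h6]
      have : f (2*j+2+1) = f (2*j+3) := rfl
      omega

lemma rep_lt (f : ℕ → ℕ) (hf : IsFSeq f) (a : ℕ → ℕ) (ha : Valid a) (N : ℕ) :
    ∑ i ∈ Finset.range N, a i * f i < f N := by
  rcases Nat.even_or_odd' N with ⟨j, rfl | rfl⟩
  · exact (rep_lt_aux f hf a ha j).1
  · exact (rep_lt_aux f hf a ha j).2

lemma rep_unique (f : ℕ → ℕ) (hf : IsFSeq f) (a b : ℕ → ℕ) (ha : Valid a) (hb : Valid b) (N : ℕ)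
    (h : ∑ i ∈ Finset.range N, a i * f i = ∑ i ∈ Finset.range N, b i * f i) :
    ∀ i < N, a i = b i := by
  induction N with
  | zero => intro i hi; omega
  | succ N ih =>
    have la := rep_lt f hf a ha N
    have lb := rep_lt f hf b hb N
    rw [Finset.sum_range_succ, Finset.sum_range_succ] at h
    have hN : a N = b N := by
      rcases Nat.le_one_iff_eq_zero_or_eq_one.1 (ha.1 N) with h1 | h1 <;>
      rcases Nat.le_one_iff_eq_zero_or_eq_one.1 (hb.1 N) with h2 | h2 <;>
      rw [h1, h2] at h <;> omega
    rw [hN] at h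
    have := ih (by omega)
    intro i hi
    rcases Nat.lt_succ_iff_lt_or_eq.1 hi with h3 | h3
    · exact this i h3
    · rw [h3, hN]

lemma sum_range_extend (c : ℕ → ℕ) (N M : ℕ) (h : ∀ i, N ≤ i → c i = 0) (hNM : N ≤ M) :
    ∑ i ∈ Finset.range M, c i = ∑ i ∈ Finset.range N, c i := by
  symm
  apply Finset.sum_subset (Finset.range_mono hNM)
  intro i _ hi
  apply h
  simpa using hi

/-- A position whose low digits vanish is the start of a block of `s`. -/
lemma block (f : ℕ → ℕ) (hf : IsFSeq f) (s : ℕ → ℕ) (hs : IsFixedSeq s) (a : ℕ → ℕ)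
    (ha : Valid a) (M : ℕ) (hM : a (2*M) = 0) : ∀ t j, j + t = M →
    (a (2*j) = 0 → ∀ i < (VW (j+1)).length,
      s (∑ l ∈ Finset.Ico (2*j) (2*M), a l * f l + i) = (VW (j+1)).getD i 0) ∧
    (a (2*j) = 1 → ∀ i < (VW j).length,
      s (∑ l ∈ Finset.Ico (2*j) (2*M), a l * f l + i) = (VW j).getD i 0) := by
  intro t
  induction t with
  | zero =>
    intro j hj
    obtain rfl : j = M := by omega
    refine ⟨?_, fun h => by omega⟩
    intro _ i hi
    have := hs j i (by rw [tauIter_eq]; exact hi)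
    rw [tauIter_eq] at this
    simpa using this
  | succ t ih =>
    intro j hj
    obtain ⟨i1, i2⟩ := ih (j+1) (by omega)
    have e : ∑ l ∈ Finset.Ico (2*j) (2*M), a l * f l =
        a (2*j) * f (2*j) + (a (2*j+1) * f (2*j+1) +
          ∑ l ∈ Finset.Ico (2*(j+1)) (2*M), a l * f l) := by
      rw [Finset.sum_eq_sum_Ico_succ_bot (by omega), Finset.sum_eq_sum_Ico_succ_bot (by omega)]
      rfl
    rw [e]
    set S := ∑ l ∈ Finset.Ico (2*(j+1)) (2*M), a l * f l with hS
    obtain ⟨l1, l2⟩ := VW_length f hf j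
    have l3 := VW_len_succ j
    have w1 : VW (j+1+1) = VW (j+1) ++ (VW j ++ VW (j+1)) := by
      rw [show VW (j+1+1) = VW (j+1) ++ VW j ++ VW (j+1) from rfl]; simp
    obtain ⟨a1, a2, a3⟩ := ha
    have c1 := a2 (2*j)
    have c2 := a2 (2*j+1)
    have c3 := a3 (2*j) ⟨j, by ring⟩
    have b1 := a1 (2*j+1)
    have b2 := a1 (2*j+2)
    rw [show 2*(j+1) = 2*j+2 by ring] at i1 i2
    constructor
    · intro h0 i hi
      rw [h0]
      rcases Nat.le_one_iff_eq_zero_or_eq_one.1 b2 with h2 | h2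
      · rcases Nat.le_one_iff_eq_zero_or_eq_one.1 b1 with h1 | h1
        · have := i1 h2 i (by omega)
          rw [w1, List.getD_append _ _ _ _ hi] at this
          rw [h1, ← this]; congr 1; ring
        · have := i1 h2 ((VW (j+1)).length + (VW j).length + i) (by omega)
          rw [w1, ← List.append_assoc, List.getD_append_right _ _ _ _
            (by rw [List.length_append]; omega), List.length_append,
            Nat.add_sub_cancel_left] at this
          rw [h1, ← this]; congr 1; omega
      · have h1 : a (2*j+1) = 0 := by simpa [h2] using c2
        have := i2 h2 i (by omega)
        rw [h1, ← this]; congr 1; ring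
    · intro h0 i hi
      have h1 : a (2*j+1) = 0 := by simpa [h0] using c1
      have h2 : a (2*j+2) = 0 := by simpa [h0] using c3
      have := i1 h2 ((VW (j+1)).length + i) (by omega)
      rw [w1, List.getD_append_right _ _ _ _ (by omega), Nat.add_sub_cancel_left,
        List.getD_append _ _ _ _ hi] at this
      rw [h0, h1, ← this]; congr 1; omega

lemma E_struct (f : ℕ → ℕ) (hf : IsFSeq f) (s : ℕ → ℕ) (hs : IsFixedSeq s) (a : ℕ → ℕ → ℕ)
    (ha : ∀ n, IsFRep f n (a n)) (k α : ℕ) :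
    ∃ β, α = β + Phi f a (k+1) α ∧
      (∀ i < (VW (k+3)).length, s (β + i) = (VW (k+3)).getD i 0) ∧
      (∀ v < f (2*k+4), Phi f a (k+1) (β + v) = v) := by
  obtain ⟨a1, a2, a3, N, hN, hα⟩ := ha α
  set g : ℕ → ℕ := fun i => if i < 2*k+5 then 0 else a α i with hg
  have gval : Valid g := by
    refine ⟨?_, ?_, ?_⟩
    · intro i
      simp only [hg]; split_ifs
      · omega
      · exact a1 i
    · intro i
      simp only [hg]
      split_ifs <;> first | exact a2 i | simp
    · intro i hi
      simp only [hg]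
      split_ifs <;> first | exact a3 i hi | simp
  set M := N + k + 3 with hM
  set β := ∑ l ∈ Finset.range (2*M), g l * f l with hβ
  have hβIco : ∀ j, 2*j ≤ 2*k+4 → ∑ l ∈ Finset.Ico (2*j) (2*M), g l * f l = β := by
    intro j hj
    rw [hβ, Finset.range_eq_Ico, ← Finset.sum_Ico_consecutive _ (Nat.zero_le (2*j)) (by omega)]
    rw [Finset.sum_eq_zero (s := Finset.Ico 0 (2*j)), zero_add]
    intro i hi
    have : i < 2*j := (Finset.mem_Ico.1 hi).2
    simp only [hg, if_pos (show i < 2*k+5 by omega), zero_mul]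
  have hsplit : ∀ (c : ℕ → ℕ), (∀ i, 2*k+5 ≤ i → c i = a α i) →
      ∑ l ∈ Finset.range (2*M), c l * f l = ∑ l ∈ Finset.range (2*k+5), c l * f l + β := by
    intro c hc
    rw [hβ, ← Finset.sum_range_add_sum_Ico _ (show 2*k+5 ≤ 2*M by omega),
      ← Finset.sum_range_add_sum_Ico (fun l => g l * f l) (show 2*k+5 ≤ 2*M by omega)]
    congr 1
    rw [Finset.sum_eq_zero (s := Finset.range (2*k+5)), zero_add]
    · apply Finset.sum_congr rfl
      intro i hi
      have : 2*k+5 ≤ i := (Finset.mem_Ico.1 hi).1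
      rw [hc i this]
      simp only [hg, if_neg (show ¬ i < 2*k+5 by omega)]
    · intro i hi
      have : i < 2*k+5 := Finset.mem_range.1 hi
      simp only [hg, if_pos this, zero_mul]
  refine ⟨β, ?_, ?_, ?_⟩
  · have h1 : α = ∑ l ∈ Finset.range (2*M), a α l * f l := by
      rw [sum_range_extend (fun l => a α l * f l) N (2*M)
        (fun i hi => by simp [hN i hi]) (by omega)]
      exact hα
    have h2 := hsplit (a α) (fun _ _ => rfl)
    rw [← h1] at h2
    rw [Phi, show 2*(k+1)+3 = 2*k+5 by ring]
    omega
  · have hgM : g (2*M) = 0 := by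
      simp only [hg, if_neg (show ¬ 2*M < 2*k+5 by omega)]
      exact hN _ (by omega)
    have := (block f hf s hs g gval M hgM (M - (k+2)) (k+2) (by omega)).1
      (by simp only [hg]; rw [if_pos (by omega)])
    rw [hβIco (k+2) (by omega)] at this
    exact this
  · intro v hv
    obtain ⟨b1, b2, b3, N', hN', hv'⟩ := ha v
    obtain ⟨c1, c2, c3, N'', hN'', hw⟩ := ha (β + v)
    have bz : ∀ i, 2*k+4 ≤ i → a v i = 0 := by
      intro i hi
      by_contra hne
      have h1 : 1 ≤ a v i := by omega
      have hiN : i < N' := by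
        by_contra h
        exact hne (hN' i (by omega))
      have h2 : a v i * f i ≤ v := by
        conv_rhs => rw [hv']
        exact Finset.single_le_sum (f := fun i => a v i * f i) (fun _ _ => Nat.zero_le _)
          (Finset.mem_range.2 hiN)
      have h3 : f (2*k+4) ≤ f i := (f_strictMono f hf).monotone hi
      have h4 : f i ≤ a v i * f i := Nat.le_mul_of_pos_left _ h1
      omega
    set h : ℕ → ℕ := fun i => if i < 2*k+5 then a v i else a α i with hh
    have hval : Valid h := by
      refine ⟨?_, ?_, ?_⟩
      · intro i
        simp only [hh]; split_ifs
        · exact b1 i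
        · exact a1 i
      · intro i
        simp only [hh]
        split_ifs with q1 q2 q2
        · exact b2 i
        · rw [bz i (by omega), zero_mul]
        · omega
        · exact a2 i
      · intro i hi
        simp only [hh]
        split_ifs with q1 q2 q2
        · exact b3 i hi
        · have : i ≠ 2*k+3 := by
            rintro rfl
            rw [Nat.even_iff] at hi
            omega
          rw [bz i (by omega), zero_mul]
        · omega
        · exact a3 i hi
    have hsv : ∑ l ∈ Finset.range (2*k+5), h l * f l = v := by
      have h1 : ∑ l ∈ Finset.range (2*k+5), h l * f l
          = ∑ l ∈ Finset.range (2*k+5), a v l * f l := by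
        apply Finset.sum_congr rfl
        intro i hi
        simp only [hh, if_pos (Finset.mem_range.1 hi)]
      rw [h1]
      have h2 := sum_range_extend (fun l => a v l * f l) N' (N' + (2*k+5))
        (fun i hi => by simp [hN' i hi]) (by omega)
      have h3 := sum_range_extend (fun l => a v l * f l) (2*k+5) (N' + (2*k+5))
        (fun i hi => by simp [bz i (by omega)]) (by omega)
      rw [← h3, h2, ← hv']
    have hsum := hsplit h (fun i hi => by
      simp only [hh, if_neg (show ¬ i < 2*k+5 by omega)])
    rw [hsv] at hsum
    have hz : ∀ i, 2*M ≤ i → h i = 0 := by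
      intro i hi
      simp only [hh, if_neg (show ¬ i < 2*k+5 by omega)]
      exact hN i (by omega)
    have u := rep_unique f hf (a (β+v)) h ⟨c1, c2, c3⟩ hval (N'' + 2*M) (by
      rw [sum_range_extend (fun l => a (β+v) l * f l) N'' (N'' + 2*M)
        (fun i hi => by simp [hN'' i hi]) (by omega), ← hw,
        sum_range_extend (fun l => h l * f l) (2*M) (N'' + 2*M)
        (fun i hi => by simp [hz i hi]) (by omega), hsum]
      ring)
    rw [Phi, show 2*(k+1)+3 = 2*k+5 by ring]
    rw [← hsv]
    conv_lhs => rw [hsv]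
    apply Finset.sum_congr rfl
    intro i hi
    rw [u i (by have := Finset.mem_range.1 hi; omega)]

/-! ### Assembly -/

lemma tri_parity (x : ℕ) : ((x+1) * x / 2) % 2 = ((x+1)/2) % 2 := by
  induction x with
  | zero => simp
  | succ x ih =>
    have := tri_succ (x+1)
    simp only [Nat.add_sub_cancel] at this
    rw [this]
    clear this
    generalize (x+1)*x/2 = T at *
    have h4 : x % 4 = 0 ∨ x % 4 = 1 ∨ x % 4 = 2 ∨ x % 4 = 3 := by omega
    rcases h4 with h | h | h | h <;> omega

lemma tri_parity' (y : ℕ) : (y * (y-1) / 2) % 2 = (y/2) % 2 := by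
  rcases y with _ | y
  · simp
  · simpa using tri_parity y

lemma neg_one_congr (a b : ℕ) (h : a % 2 = b % 2) : (-1 : ℤ)^a = (-1)^b := by
  rw [neg_one_pow_eq_pow_mod_two, h, ← neg_one_pow_eq_pow_mod_two]

lemma par1 (x y p q k T1 T2 T3 : ℕ) (t1 : T1 % 2 = ((x+1)/2) % 2) (t2 : T2 % 2 = (y/2) % 2)
    (t3 : T3 % 2 = (p/2) % 2) (hp : p % 2 = 1) (hq : q % 2 = (k+1) % 2)
    (h : x + y + 1 = p + 2*q) :
    (k % 2 = 0 → (T1 + T2 + y + T3) % 2 = (1 + x) % 2) ∧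
    (k % 2 = 1 → (T1 + x + T2 + T3) % 2 = x % 2) := by
  obtain ⟨a, ha | ha⟩ := Nat.even_or_odd' x <;> obtain ⟨b, hb | hb⟩ := Nat.even_or_odd' y <;>
  obtain ⟨c, hc | hc⟩ := Nat.even_or_odd' p <;> subst ha hb hc <;> constructor <;> intro hk <;>
  omega

lemma par2 (p q k T3 : ℕ) (t3 : T3 % 2 = (p/2) % 2) (hp : p % 2 = 1) (hq : q % 2 = (k+1) % 2) :
    T3 % 2 = (k + 1 + (p + 2*q - 1)/2) % 2 := by
  have : (p + 2*q - 1)/2 = p/2 + q := by omega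
  rw [this]
  omega

lemma par3 (x z p q k T1 T2 T3 T4 : ℕ) (t1 : T1 % 2 = ((x+1)/2) % 2) (t4 : T4 % 2 = (x/2) % 2)
    (t2 : T2 % 2 = (z/2) % 2)
    (t3 : T3 % 2 = (p/2) % 2) (hp : p % 2 = 1) (hq : q % 2 = (k+1) % 2)
    (h : x + z + 1 = p + 2*q) :
    (k % 2 = 0 → (T4 + x + T3) % 2 = (1 + T2) % 2) ∧
    (k % 2 = 1 → (T4 + T3) % 2 = (1 + (z+1) + T2) % 2) ∧
    (k % 2 = 0 → (T1 + T3) % 2 = (1 + T2) % 2) ∧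
    (k % 2 = 1 → (T1 + x + T3) % 2 = (1 + (z+1) + T2) % 2) := by
  have e3 : p = 2*(p/2)+1 := by omega
  generalize p/2 = c at *
  subst e3
  rcases Nat.even_or_odd' x with ⟨a, ha | ha⟩ 
  · obtain ⟨b, hb⟩ : ∃ b, z = 2*b := ⟨z/2, by omega⟩
    subst ha hb
    have e1 : (2*a+1)/2 = a := by omega
    have e4 : (2*a)/2 = a := by omega
    have e2 : (2*b)/2 = b := by omega
    rw [e1] at t1; rw [e2] at t2; rw [e4] at t4
    clear e1 e2 e4
    refine ⟨?_, ?_, ?_, ?_⟩ <;> intro hk <;> omega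
  · obtain ⟨b, hb⟩ : ∃ b, z = 2*b+1 := ⟨z/2, by omega⟩
    subst ha hb
    have e1 : (2*a+1+1)/2 = a+1 := by omega
    have e4 : (2*a+1)/2 = a := by omega
    have e2 : (2*b+1)/2 = b := by omega
    rw [e1] at t1; rw [e2] at t2; rw [e4] at t4
    clear e1 e2 e4
    refine ⟨?_, ?_, ?_, ?_⟩ <;> intro hk <;> omega

/-- Values of `H` on the frame of a window. -/
lemma frame (f : ℕ → ℕ) (hf : IsFSeq f) (s : ℕ → ℕ) (k β p q : ℕ)
    (hp : p = f (2*k)) (hq : 2 * q = f (2*k+1))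
    (hd : ∀ e, q ≤ e → e < 2*p + 4*q → ((s (β + e + p) : ℕ) : ℤ) - ((s (β + e) : ℕ) : ℤ)
      = (-1)^(k+1) * ((if e = q - 1 then 1 else 0) - (if e = q then 1 else 0)
        + (if e = 2*p + 3*q - 1 then 1 else 0) - (if e = 2*p+3*q then 1 else 0)))
    (hmid : ∀ i < p, s (β + 2*q + i) = (VW (k+1)).getD i 0)
    (m n x y : ℕ) (hn : n = p + y + x)
    (h1 : β + q + 1 ≤ m + x) (h2 : m + x + n ≤ β + 2*p + 3*q)
    (hx : 0 < x → m + x = β + q + 1) (hy : 0 < y → m + x + n = β + 2*p + 3*q) :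
    H s m n = (-1)^((x+1) * x / 2) * ((-1)^k)^x * ((-1)^(y * (y-1) / 2) * ((-1)^(k+1))^y *
        ((-1)^(p * (p-1)/2) * (q : ℤ))) := by
  subst hn
  obtain ⟨l1, l2⟩ := VW_length f hf k
  obtain ⟨s1, s2⟩ := VW_sum f hf k
  obtain ⟨pp, podd⟩ := f_pos_even f hf k
  have hlp := VW_pos k
  have hqp : q ≤ p := by omega
  have hq1 : 1 ≤ q := by omega
  rw [← hp] at podd l1 pp l2
  have per0 : ∀ e, q + 1 ≤ e → e + 1 < 2*p + 3*q →
      ((s (β + e + p) : ℕ) : ℤ) - ((s (β + e) : ℕ) : ℤ) = 0 := by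
    intro e he1 he2
    rw [hd e (by omega) (by omega), if_neg (by omega), if_neg (by omega), if_neg (by omega),
      if_neg (by omega)]
    ring
  have hb := hankel_block (fun i => ((s (m + i) : ℕ) : ℤ)) p x y podd ((-1)^k) ((-1)^(k+1))
    (by
      intro e he1 he2
      obtain ⟨z, hz⟩ := Nat.exists_eq_add_of_le (show β ≤ m + e by omega)
      have := per0 z (by omega) (by omega)
      rw [← hz] at this
      simpa [add_assoc] using this)
    (by
      intro hx0
      have hmx := hx hx0
      have := hd q (by omega) (by omega)
      rw [if_neg (by omega), if_pos rfl, if_neg (by omega), if_neg (by omega)] at this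
      rw [show m + (x - 1 + p) = β + q + p by omega, show m + (x - 1) = β + q by omega, this,
        pow_succ]
      ring)
    (by
      intro hy0
      have hmy := hy hy0
      have := hd (2*p+3*q-1) (by omega) (by omega)
      rw [if_neg (by omega), if_neg (by omega), if_pos rfl, if_neg (by omega)] at this
      rw [show m + (x + (p + y + x) - 1 + p) = β + (2*p+3*q-1) + p by omega,
        show m + (x + (p + y + x) - 1) = β + (2*p+3*q-1) by omega, this]
      ring)
  have hH : H s m (p + y + x)
      = (Matrix.of fun i j : Fin (p + y + x) => ((s (m + (i + j)) : ℕ) : ℤ)).det := by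
    rw [H]
    simp only [add_assoc]
  rw [hH, hb]
  congr 2
  -- periodicity
  have per : ∀ t z, q + 1 ≤ z → z + t * p + 1 < 3*p + 3*q → s (β + z) = s (β + (z + t * p)) := by
    intro t
    induction t with
    | zero => intro z _ _; simp
    | succ t ih =>
      intro z hz1 hz2
      rw [Nat.succ_mul] at hz2
      rw [ih z hz1 (by omega)]
      have := per0 (z + t * p) (by omega) (by omega)
      rw [Nat.succ_mul]
      have h3 : s (β + (z + t * p) + p) = s (β + (z + t * p)) := by omega
      rw [← h3]
      congr 1; ring
  have val : ∀ z, q + 1 ≤ z → z + 1 < 3*p + 3*q →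
      s (β + z) = (VW (k+1)).getD ((z + 2*p - 2*q) % p) 0 := by
    intro z hz1 hz2
    have hr := Nat.mod_lt (z + 2*p - 2*q) (show 0 < p by omega)
    have hdm := Nat.div_add_mod' (z + 2*p - 2*q) p
    set R := (z + 2*p - 2*q) % p with hR
    set Q := (z + 2*p - 2*q) / p with hQ
    rw [← hmid R hr]
    rcases le_or_gt 2 Q with h | h
    · obtain ⟨t, ht⟩ := Nat.exists_eq_add_of_le h
      rw [ht, add_mul] at hdm
      have := per t (2*q + R) (by omega) (by omega)
      rw [show β + 2*q + R = β + (2*q+R) by ring, this]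
      congr 1; omega
    · obtain ⟨t, ht⟩ := Nat.exists_eq_add_of_le h.le
      have h4 : 2 * p = Q * p + t * p := by rw [← add_mul, ← ht]
      have := per t z (by omega) (by omega)
      rw [this]
      congr 1; omega
  have hc := hankel_VW k (by rw [l1]; exact podd) (m + x - β + 2*p - 2*q)
  rw [show (VW (k+1)).sum = q by omega] at hc
  have key : ∀ p', p' = p → (Matrix.of fun i j : Fin p' => ((s (m + (x + i + j)) : ℕ) : ℤ)).det
     = (Matrix.of fun i j : Fin p' =>
      (((VW (k+1)).getD ((m + x - β + 2*p - 2*q + i + j) % p') 0 : ℕ) : ℤ)).det := by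
    intro p' hp'
    subst hp'
    congr 1
    ext i j
    have hi := i.2
    have hj := j.2
    simp only [Matrix.of_apply]
    rw [show m + (x + (i:ℕ) + j) = β + (m + x + i + j - β) by omega,
      val _ (by omega) (by omega)]
    congr 4
    omega
  rw [← key _ l1] at hc
  rw [l1] at hc
  exact hc

set_option maxHeartbeats 4000000 in
theorem hankel_on_U (f : ℕ → ℕ) (hf : IsFSeq f) (s : ℕ → ℕ) (hs : IsFixedSeq s) (a : ℕ → ℕ → ℕ) (ha : ∀ n, IsFRep f n (a n)) :
    ∀ k m n : ℕ, 1 ≤ n →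
      f (2*k) ≤ n → n < f (2*k+3) →
      (∃ α : ℕ, Phi f a (k+1) α = f (2*k+5) / 2 ∧
        α - f (2*k+2) < m + n ∧ m + n ≤ α) →
      ((n = f (2*k+3) - 1 →
          H s m n = (-1 : ℤ)^(k+1) * (-1 : ℤ)^(f (2*k+5) / 2 - Phi f a (k+1) (m+n)) *
            (f (2*k+1) / 2 : ℤ)) ∧
       (n = f (2*k) →
          H s m n = (-1 : ℤ)^(k+1) * (-1 : ℤ)^((f (2*k+2) - 1) / 2) *
            (f (2*k+1) / 2 : ℤ)) ∧
       (f (2*k) < n → n < f (2*k+3) - 1 →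
          ((Phi f a (k+1) (m+n) = f (2*k+5) / 2 ∨
              Phi f a (k+1) (m + n + f (2*k+2) - 1) = f (2*k+5) / 2) →
            H s m n = -((-1 : ℤ)^((f (2*k+3) - n) * k) *
              (-1 : ℤ)^((f (2*k+3) - 1 - n) * (f (2*k+3) - 2 - n) / 2) *
              (f (2*k+1) / 2 : ℤ))) ∧
          (¬(Phi f a (k+1) (m+n) = f (2*k+5) / 2 ∨
              Phi f a (k+1) (m + n + f (2*k+2) - 1) = f (2*k+5) / 2) →
            H s m n = 0))) := by
  intro k m n hn1 hnp hnf ⟨α, hα, hα1, hα2⟩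
  obtain ⟨β, hβ, hblock, hPhi⟩ := E_struct f hf s hs a ha k α
  obtain ⟨l1, l2⟩ := VW_length f hf k
  obtain ⟨s1, s2⟩ := VW_sum f hf k
  obtain ⟨pp, podd⟩ := f_pos_even f hf k
  have hlp := VW_pos k
  have qpar := VW_sum_parity (k+1)
  have l3 := (VW_length f hf (k+2)).1
  rw [show k+2+1 = k+3 by ring, show 2*(k+2) = 2*k+4 by ring] at l3
  obtain ⟨p, hp⟩ : ∃ p, p = f (2*k) := ⟨_, rfl⟩
  obtain ⟨q, hq⟩ : ∃ q, q = (VW (k+1)).sum := ⟨_, rfl⟩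
  rw [← hq] at s1 qpar s2
  have f2 : f (2*k+2) = p + 2*q := by rw [hf.2.2.1 k]; omega
  have f3 : f (2*k+3) = 2*p + 2*q := by rw [hf.2.2.2 k]; omega
  have f4 : f (2*k+4) = 3*p + 4*q := by
    have := hf.2.2.1 (k+1)
    rw [show 2*(k+1)+2 = 2*k+4 by ring, show 2*(k+1)+1 = 2*k+3 by ring,
      show 2*(k+1) = 2*k+2 by ring] at this
    omega
  have f5 : f (2*k+5) / 2 = 2*p + 3*q := by
    have := hf.2.2.2 (k+1)
    rw [show 2*(k+1)+2 = 2*k+4 by ring, show 2*(k+1)+3 = 2*k+5 by ring,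
      show 2*(k+1) = 2*k+2 by ring] at this
    omega
  have fq : ((f (2*k+1) : ℤ) / 2) = (q : ℤ) := by omega
  rw [fq]
  rw [hα, f5] at hβ
  rw [← hp] at pp podd l1 l2 hnp s2
  rw [← hp]
  rw [f5] at hα
  rw [f2] at hα1
  rw [f3] at hnf
  rw [f4] at hPhi l3
  rw [f2, f3, f5]
  have hq1 : 1 ≤ q := by omega
  have hqp : q ≤ p := by omega
  have hd : ∀ e, q ≤ e → e < 2*p + 4*q → ((s (β + e + p) : ℕ) : ℤ) - ((s (β + e) : ℕ) : ℤ)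
      = (-1)^(k+1) * ((if e = q - 1 then 1 else 0) - (if e = q then 1 else 0)
        + (if e = 2*p + 3*q - 1 then 1 else 0) - (if e = 2*p+3*q then 1 else 0)) := by
    intro e _ he
    have := VW_runs_aux k (by omega) e (by omega)
    rw [l1, ← hq, show 3 * p + (VW k).length + q = 2*p + 3*q by omega] at this
    rw [← this, ← hblock e (by omega), ← hblock (e + p) (by omega), add_assoc]
  have hmid : ∀ i < p, s (β + 2*q + i) = (VW (k+1)).getD i 0 := by
    intro i hi
    rw [← VW_mid k i (by omega), add_assoc, hblock _ (by omega)]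
    congr 1
    omega
  have hframe := frame f hf s k β p q hp s1 hd hmid m n
  have hPmn : Phi f a (k+1) (m+n) = m + n - β := by
    have := hPhi (m + n - β) (by omega)
    rwa [show β + (m + n - β) = m + n by omega] at this
  have c1 : Phi f a (k+1) (m+n) = 2*p+3*q ↔ m + n = α := by
    rw [hPmn]; omega
  have c2 : Phi f a (k+1) (m + n + (p + 2*q) - 1) = 2*p+3*q ↔ m + n + (p + 2*q) - 1 = α := by
    constructor
    · intro h
      obtain ⟨β', hβ', -, hPhi'⟩ := E_struct f hf s hs a ha k (m + n + (p + 2*q) - 1)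
      rw [h] at hβ'
      have e1 := hPhi' 0 (by omega)
      have e2 := hPhi (β' - β) (by omega)
      rw [show β + (β' - β) = β' + 0 by omega, e1] at e2
      omega
    · intro h; rw [h]; exact hα
  rw [c1, c2]
  have P1 := fun x y => par1 x y p q k _ _ _ (tri_parity x) (tri_parity' y) (tri_parity' p)
    podd qpar
  have P2 := par2 p q k _ (tri_parity' p) podd qpar
  have P3 := fun x z => par3 x z p q k _ _ _ _ (tri_parity x) (tri_parity' x) (tri_parity' z)
    (tri_parity' p) podd qpar
  clear c1 c2 qpar podd f2 f3 f4 f5 fq l1 l2 l3 s1 s2 hlp hp hq hα pp hn1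
  refine ⟨?_, ?_, ?_⟩
  · clear P2
    intro hn
    rw [hframe (α - (m+n)) (n - p - (α - (m + n))) (by omega) (by omega) (by omega)
      (by omega) (by omega)]
    rw [hPmn]
    obtain ⟨x, hx⟩ : ∃ x, x = α - (m+n) := ⟨_, rfl⟩
    obtain ⟨y, hy⟩ : ∃ y, y = n - p - (α - (m+n)) := ⟨_, rfl⟩
    rw [← hy, ← hx, show 2*p+3*q - (m + n - β) = x by omega]
    have P := P1 x y (by omega)
    rcases Nat.even_or_odd k with hk | hk
    · rw [hk.neg_one_pow, hk.add_one.neg_one_pow, one_pow]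
      have := neg_one_congr ((x+1)*x/2 + y*(y-1)/2 + y + p*(p-1)/2) (1 + x) (P.1 (Nat.even_iff.mp hk))
      simp only [pow_add, pow_one] at this ⊢
      linear_combination (q : ℤ) * this
    · rw [hk.neg_one_pow, hk.add_one.neg_one_pow, one_pow]
      have := neg_one_congr ((x+1)*x/2 + x + y*(y-1)/2 + p*(p-1)/2) x (P.2 (Nat.odd_iff.mp hk))
      simp only [pow_add, pow_one] at this ⊢
      linear_combination (q : ℤ) * this
  · intro hn
    have hf0 := hframe 0 0 (by clear P2; omega) (by clear P2; omega) (by clear P2; omega)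
      (by omega) (by omega)
    rw [hf0]
    have := neg_one_congr (p*(p-1)/2) (k + 1 + (p + 2*q - 1)/2) P2
    rw [pow_add] at this
    simp only [zero_add, Nat.mul_zero, Nat.zero_mul, Nat.zero_div, pow_zero, one_mul]
    rw [this]
  · clear P2
    intro hn2 hn3
    constructor
    · intro hor
      obtain ⟨z, hz⟩ : ∃ z, z = 2*p + 2*q - 1 - n := ⟨_, rfl⟩
      rw [show 2*p+2*q-n = z + 1 by omega, show 2*p+2*q-2-n = z - 1 by omega, ← hz]
      obtain ⟨x, hx⟩ : ∃ x, x = n - p := ⟨_, rfl⟩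
      rcases hor with h | h
      · rw [hframe 0 x (by omega) (by omega) (by omega) (by omega) (by omega)]
        have P := P3 x z (by omega)
        simp only [zero_add, Nat.mul_zero, Nat.zero_div, pow_zero, one_mul]
        rcases Nat.even_or_odd k with hk | hk
        · rw [hk.add_one.neg_one_pow, (hk.mul_left (z+1)).neg_one_pow]
          have := neg_one_congr (x*(x-1)/2 + x + p*(p-1)/2) (1 + z*(z-1)/2) (P.1 (Nat.even_iff.mp hk))
          simp only [pow_add, pow_one] at this ⊢
          linear_combination (q : ℤ) * this
        · rw [hk.add_one.neg_one_pow, mul_comm (z+1) k, pow_mul, hk.neg_one_pow, one_pow]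
          have := neg_one_congr (x*(x-1)/2 + p*(p-1)/2) (1 + (z + 1) + z*(z-1)/2) (P.2.1 (Nat.odd_iff.mp hk))
          simp only [pow_add, pow_one] at this ⊢
          linear_combination (q : ℤ) * this
      · rw [hframe x 0 (by omega) (by omega) (by omega) (by omega) (by omega)]
        have P := P3 x z (by omega)
        simp only [Nat.zero_mul, Nat.zero_div, pow_zero, one_mul]
        rcases Nat.even_or_odd k with hk | hk
        · rw [hk.neg_one_pow, (hk.mul_left (z+1)).neg_one_pow, one_pow]
          have := neg_one_congr ((x+1)*x/2 + p*(p-1)/2) (1 + z*(z-1)/2) (P.2.2.1 (Nat.even_iff.mp hk))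
          simp only [pow_add, pow_one] at this ⊢
          linear_combination (q : ℤ) * this
        · rw [hk.neg_one_pow, mul_comm (z+1) k, pow_mul, hk.neg_one_pow]
          have := neg_one_congr ((x+1)*x/2 + x + p*(p-1)/2) (1 + (z + 1) + z*(z-1)/2) (P.2.2.2 (Nat.odd_iff.mp hk))
          simp only [pow_add, pow_one] at this ⊢
          linear_combination (q : ℤ) * this
    · intro hnor
      rw [not_or] at hnor
      obtain ⟨i, hi⟩ : ∃ i, i = β + q + 1 - m := ⟨_, rfl⟩
      rw [H]
      apply Matrix.det_zero_of_row_eq (i := ⟨i, by omega⟩) (j := ⟨i + p, by omega⟩)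
      · intro h
        rw [Fin.mk.injEq] at h
        omega
      · ext j
        have hj := j.2
        simp only [Matrix.of_apply]
        have := hd (m + i + j - β) (by omega) (by omega)
        rw [if_neg (by omega), if_neg (by omega), if_neg (by omega), if_neg (by omega),
          show β + (m + i + j - β) = m + i + j by omega] at this
        rw [show m + (i + p) + (j:ℕ) = m + i + j + p by ring]
        linarith
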